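/- Let Ω be an algebraically closed field of characteristic 0 and let F₀ ⊆ A ⊆ K be subfields of Ω. Assume that alg(K) = alg(F₀)·K and that every element of K algebraic over A lies in A (i.e. alg(A) ∩ K ⊆ A). Then alg(A) = alg(F₀)·A. -/

import Mathlib

/-- The relative algebraic closure of a subfield `E` inside `Ω`: the subfield of all
elements of `Ω` that are algebraic (equivalently, integral) over `E`. -/
def algClo {Ω : Type*} [Field Ω] (E : Subfield Ω) : Subfield Ω where
  carrier := {x : Ω | IsIntegral E x}
  mul_mem' := fun ha hb => ha.mul hb
  one_mem' := isIntegral_one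
  add_mem' := fun ha hb => ha.add hb
  zero_mem' := isIntegral_zero
  neg_mem' := fun ha => ha.neg
  inv_mem' := fun _ hx => hx.inv

section IntegrallyClosedInField

open IntermediateField

variable {A K Ω : Type*} [Field A] [Field K] [Field Ω] [Algebra A K] [Algebra A Ω] [Algebra K Ω]
  [IsScalarTower A K Ω]

/-- If `A` is algebraically closed in `K`, the minimal polynomial over `A` of an element algebraic
over `A` is also its minimal polynomial over `K`. -/
theorem minpoly.map_eq_of_isIntegrallyClosedIn [IsIntegrallyClosedIn A K] {x : Ω}
    (hx : IsIntegral A x) : (minpoly A x).map (algebraMap A K) = minpoly K x := by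
  have hxK : IsIntegral K x := hx.tower_top
  have hlifts : minpoly K x ∈ Polynomial.lifts (algebraMap A K) := by
    rw [Polynomial.lifts_iff_coeff_lifts]
    intro n
    exact IsIntegrallyClosedIn.isIntegral_iff.mp
      (Polynomial.isIntegral_coeff_of_dvd (minpoly A x) (minpoly K x) (minpoly.monic hx)
        (minpoly.monic hxK) (minpoly.dvd_map_of_isScalarTower A K x) n)
  obtain ⟨q, hq, -, hqm⟩ :=
    Polynomial.lifts_and_degree_eq_and_monic hlifts (minpoly.monic hxK)
  have hroot : Polynomial.aeval x q = 0 := by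
    rw [← Polynomial.aeval_map_algebraMap K, hq, minpoly.aeval]
  refine Polynomial.eq_of_monic_of_dvd_of_natDegree_le (minpoly.monic hxK)
    ((minpoly.monic hx).map _) (minpoly.dvd_map_of_isScalarTower A K x) ?_
  rw [Polynomial.natDegree_map, ← hq, Polynomial.natDegree_map]
  exact Polynomial.natDegree_le_natDegree (minpoly.min A x hqm hroot)

/-- A finite separable subextension is generated by a single element. -/
theorem IntermediateField.exists_adjoin_simple_eq (N : IntermediateField A Ω)
    [FiniteDimensional A N] [Algebra.IsSeparable A N] : ∃ x : Ω, A⟮x⟯ = N := by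
  obtain ⟨x, hx⟩ := Field.exists_primitive_element A N
  exact ⟨x, by rw [← lift_adjoin_simple, hx, lift_top]⟩

/-- If `A` is algebraically closed in `K`, then an element algebraic over `A` that lies in `K(y)`,
with `y` algebraic over `A`, already lies in `A(y)`. -/
theorem IntermediateField.mem_adjoin_simple_of_isIntegrallyClosedIn [CharZero A]
    [IsIntegrallyClosedIn A K] {x y : Ω} (hx : IsIntegral A x) (hy : IsIntegral A y)
    (hxy : x ∈ K⟮y⟯) : x ∈ A⟮y⟯ := by
  have : FiniteDimensional A (adjoin A ({y, x} : Set Ω)) :=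
    finiteDimensional_adjoin (by rintro z (rfl | rfl) <;> assumption)
  obtain ⟨z, hz⟩ := exists_adjoin_simple_eq (adjoin A ({y, x} : Set Ω))
  have hle : A⟮y⟯ ≤ A⟮z⟯ := hz ▸ adjoin.mono A _ _ (by simp)
  have hfin : FiniteDimensional A A⟮z⟯ := hz ▸ this
  have hzint : IsIntegral A z :=
    isIntegral_iff.mp (Algebra.IsIntegral.isIntegral (R := A) (AdjoinSimple.gen A z))
  have hzK : z ∈ K⟮y⟯ := by
    have h : adjoin A ({y, x} : Set Ω) ≤ K⟮y⟯.restrictScalars A := by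
      rw [adjoin_le_iff]
      rintro w (rfl | rfl)
      · exact mem_adjoin_simple_self K w
      · exact hxy
    exact h (hz ▸ mem_adjoin_simple_self A z)
  have hyK : IsIntegral K y := hy.tower_top
  have : FiniteDimensional K K⟮y⟯ := adjoin.finiteDimensional hyK
  have hdeg : Module.finrank A A⟮z⟯ ≤ Module.finrank A A⟮y⟯ := by
    have h := finrank_le_of_le_right (adjoin_simple_le_iff.mpr hzK)
    rwa [adjoin.finrank hyK, adjoin.finrank hzint.tower_top,
      ← minpoly.map_eq_of_isIntegrallyClosedIn hy, ← minpoly.map_eq_of_isIntegrallyClosedIn hzint,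
      Polynomial.natDegree_map, Polynomial.natDegree_map, ← adjoin.finrank hy,
      ← adjoin.finrank hzint] at h
  rw [eq_of_le_of_finrank_le hle hdeg, hz]
  exact subset_adjoin A _ (by simp)

/-- If `A` is algebraically closed in `K`, then an element algebraic over `A` that lies in `K(S)`,
with `S` algebraic over `A`, already lies in `A(S)`. -/
theorem IntermediateField.mem_adjoin_of_isIntegrallyClosedIn [CharZero A]
    [IsIntegrallyClosedIn A K] {x : Ω} {S : Set Ω} (hx : IsIntegral A x)
    (hS : ∀ y ∈ S, IsIntegral A y) (hxS : x ∈ adjoin K S) : x ∈ adjoin A S := by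
  obtain ⟨T, hTS, hxT⟩ := exists_finset_of_mem_adjoin hxS
  have : FiniteDimensional A (adjoin A (T : Set Ω)) :=
    finiteDimensional_adjoin fun y hy ↦ hS y (hTS hy)
  obtain ⟨y, hy⟩ := exists_adjoin_simple_eq (adjoin A (T : Set Ω))
  have hfin : FiniteDimensional A A⟮y⟯ := hy ▸ this
  have hyint : IsIntegral A y :=
    isIntegral_iff.mp (Algebra.IsIntegral.isIntegral (R := A) (AdjoinSimple.gen A y))
  have hle : adjoin K (T : Set Ω) ≤ K⟮y⟯ := by
    rw [adjoin_le_iff]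
    intro t ht
    have h : A⟮y⟯ ≤ K⟮y⟯.restrictScalars A :=
      adjoin_simple_le_iff.mpr (mem_adjoin_simple_self K y)
    exact h (hy ▸ subset_adjoin A _ ht)
  have hxy := mem_adjoin_simple_of_isIntegrallyClosedIn hx hyint (hle hxT)
  rw [hy] at hxy
  exact adjoin.mono A _ _ hTS hxy

end IntegrallyClosedInField

section AlgClo

variable {Ω : Type*} [Field Ω]

theorem le_algClo (E : Subfield Ω) : E ≤ algClo E :=
  fun x hx ↦ isIntegral_algebraMap (x := (⟨x, hx⟩ : E))

theorem algClo_mono {E F : Subfield Ω} (h : E ≤ F) : algClo E ≤ algClo F := by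
  intro x hx
  let : Algebra E F := (Subfield.inclusion h).toAlgebra
  have : IsScalarTower E F Ω := .of_algebraMap_eq fun _ ↦ rfl
  exact IsIntegral.tower_top (R := E) hx

theorem Subfield.mem_sup_iff_mem_adjoin {L E : Subfield Ω} {x : Ω} :
    x ∈ L ⊔ E ↔ x ∈ IntermediateField.adjoin E (L : Set Ω) := by
  constructor
  · have h : L ⊔ E ≤ (IntermediateField.adjoin E (L : Set Ω)).toSubfield :=
      sup_le (fun y hy ↦ IntermediateField.subset_adjoin E _ hy)
        fun y hy ↦ (IntermediateField.adjoin E (L : Set Ω)).algebraMap_mem ⟨y, hy⟩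
    exact fun hx ↦ h hx
  · have h : IntermediateField.adjoin E (L : Set Ω) ≤
        (L ⊔ E).toIntermediateField fun y ↦ (le_sup_right : E ≤ L ⊔ E) y.2 :=
      IntermediateField.adjoin_le_iff.mpr (le_sup_left : L ≤ L ⊔ E)
    exact fun hx ↦ h hx

end AlgClo

theorem stmt2 {Ω : Type*} [Field Ω] [IsAlgClosed Ω] [CharZero Ω]
    (F₀ A K : Subfield Ω) (hF₀A : F₀ ≤ A) (hAK : A ≤ K)
    (hK : algClo K = algClo F₀ ⊔ K)
    (hA : algClo A ⊓ K ≤ A) :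
    algClo A = algClo F₀ ⊔ A := by
  refine le_antisymm (fun x hx ↦ ?_) (sup_le (algClo_mono hF₀A) (le_algClo A))
  let : Algebra A K := (Subfield.inclusion hAK).toAlgebra
  have : IsScalarTower A K Ω := .of_algebraMap_eq fun _ ↦ rfl
  have : IsIntegrallyClosedIn A K := by
    refine isIntegrallyClosedIn_iff.mpr ⟨(algebraMap A K).injective, fun {y} hy ↦ ?_⟩
    exact ⟨⟨y, hA ⟨hy.algebraMap (B := Ω), y.2⟩⟩, rfl⟩
  have hxK : x ∈ algClo F₀ ⊔ K := hK ▸ algClo_mono hAK hx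
  rw [Subfield.mem_sup_iff_mem_adjoin] at hxK ⊢
  exact IntermediateField.mem_adjoin_of_isIntegrallyClosedIn hx
    (fun y hy ↦ algClo_mono hF₀A hy) hxK
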